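/- arXiv:1412.8252 — 2 statements merged into one kernel-verified Lean document; each statement's English description precedes it below -/
import Mathlib

section
/- For every integer l_B ≥ m and every real ν with |ν| > 1, √((l_B+1)² − m²) · ( p_{l_B+1}^m(ν) q_{l_B}^m(ν) − p_{l_B}^m(ν) q_{l_B+1}^m(ν) ) = 1. -/
open MeasureTheory Filter

/-- Legendre polynomial via Rodrigues' formula. -/
noncomputable def legendreP (l : ℕ) (x : ℝ) : ℝ :=
  (1 / (2 ^ l * (Nat.factorial l : ℝ))) *
    iteratedDeriv l (fun y : ℝ => (y ^ 2 - 1) ^ l) x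

/-- `p_l^m(μ) = √((l−m)!/(l+m)!) (d/dμ)^m P_l(μ)`; it vanishes for `l < m`
(in particular the convention `p_{m−1}^m = 0` holds). -/
noncomputable def pml (m l : ℕ) (μ : ℝ) : ℝ :=
  Real.sqrt ((Nat.factorial (l - m) : ℝ) / (Nat.factorial (l + m) : ℝ)) *
    iteratedDeriv m (legendreP l) μ

/-- `q_l^m(w) = (1/2) ∫_{−1}^{1} p_l^m(μ)/(w−μ) (1−μ²)^m dμ`. -/
noncomputable def qml (m l : ℕ) (w : ℝ) : ℝ :=
  (1 / 2) * ∫ μ in (-1 : ℝ)..1, pml m l μ / (w - μ) * (1 - μ ^ 2) ^ m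

/-- `h_l = 2l+1 − ϖ β_l` for `l ≤ L`, and `h_l = 2l+1` for `l > L`. -/
noncomputable def hcoef (ϖ : ℝ) (β : ℕ → ℝ) (L l : ℕ) : ℝ :=
  if l ≤ L then 2 * l + 1 - ϖ * β l else 2 * l + 1

/-- Auxiliary recursion: `chandraAux ϖ β L m ν n = g_{m+n}^m(ν)`, built from the
initial value `g_m^m(ν) = √((2m)!)/(2^m m!)`, the convention `g_{m−1}^m = 0`, and the
three-term recurrence `ν h_l g_l^m = √((l+1)²−m²) g_{l+1}^m + √(l²−m²) g_{l−1}^m`. -/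
noncomputable def chandraAux (ϖ : ℝ) (β : ℕ → ℝ) (L m : ℕ) (ν : ℝ) : ℕ → ℝ
  | 0 => Real.sqrt (Nat.factorial (2 * m)) / (2 ^ m * Nat.factorial m)
  | 1 => ν * hcoef ϖ β L m *
      (Real.sqrt (Nat.factorial (2 * m)) / (2 ^ m * Nat.factorial m)) /
      Real.sqrt (((m : ℝ) + 1) ^ 2 - (m : ℝ) ^ 2)
  | n + 2 =>
      (ν * hcoef ϖ β L (m + n + 1) * chandraAux ϖ β L m ν (n + 1) -
          Real.sqrt (((m + n + 1 : ℕ) : ℝ) ^ 2 - (m : ℝ) ^ 2) * chandraAux ϖ β L m ν n) /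
        Real.sqrt (((m + n + 2 : ℕ) : ℝ) ^ 2 - (m : ℝ) ^ 2)

/-- The normalized Chandrasekhar polynomial `g_l^m(ν)` (with value `0` for `l < m`). -/
noncomputable def gml (ϖ : ℝ) (β : ℕ → ℝ) (L m l : ℕ) (ν : ℝ) : ℝ :=
  if l < m then 0 else chandraAux ϖ β L m ν (l - m)

/-- `g^m(ν,μ) = Σ_{l=m}^{L} β_l p_l^m(μ) g_l^m(ν)`. -/
noncomputable def gfun (ϖ : ℝ) (β : ℕ → ℝ) (L m : ℕ) (ν μ : ℝ) : ℝ :=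
  ∑ l ∈ Finset.Icc m L, β l * pml m l μ * gml ϖ β L m l ν

/-- `Λ^m(w) = 1 − (ϖ w/2) ∫_{−1}^{1} g^m(w,μ)/(w−μ) (1−μ²)^m dμ`. -/
noncomputable def Lam (ϖ : ℝ) (β : ℕ → ℝ) (L m : ℕ) (w : ℝ) : ℝ :=
  1 - ϖ * w / 2 * ∫ μ in (-1 : ℝ)..1, gfun ϖ β L m w μ / (w - μ) * (1 - μ ^ 2) ^ m

/-- The off-diagonal entry `b_l = √((l²−m²)/(h_l h_{l−1}))`. -/
noncomputable def bcoef (ϖ : ℝ) (β : ℕ → ℝ) (L m l : ℕ) : ℝ :=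
  Real.sqrt (((l : ℝ) ^ 2 - (m : ℝ) ^ 2) / (hcoef ϖ β L l * hcoef ϖ β L (l - 1)))

/-- The symmetric tridiagonal matrix `B(m)` with rows/columns indexed by
`l ∈ {m, …, l_B}` (here `l = m + i` for `i : Fin (l_B − m + 1)`), zero diagonal and
off-diagonal entries `B(m)_{l,l−1} = B(m)_{l−1,l} = b_l`. -/
noncomputable def Bmat (ϖ : ℝ) (β : ℕ → ℝ) (L m lB : ℕ) :
    Matrix (Fin (lB - m + 1)) (Fin (lB - m + 1)) ℝ :=
  fun i j =>
    if (i : ℕ) + 1 = (j : ℕ) then bcoef ϖ β L m (m + j)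
    else if (j : ℕ) + 1 = (i : ℕ) then bcoef ϖ β L m (m + i)
    else 0


open Polynomial in
/-- The `m`-th derivative of the Legendre polynomial `P_l`, as a polynomial. -/
noncomputable def legendreDeriv (m l : ℕ) : ℝ[X] :=
  C (1 / (2 ^ l * (Nat.factorial l : ℝ))) * derivative^[l + m] ((X ^ 2 - 1) ^ l)

open Polynomial in
theorem iteratedDeriv_eval (n : ℕ) (p : ℝ[X]) :
    iteratedDeriv n (fun x => p.eval x) = fun x => (derivative^[n] p).eval x := by
  induction n with
  | zero => simp
  | succ n ih =>
    rw [iteratedDeriv_succ, ih]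
    funext x
    rw [Polynomial.deriv, Function.iterate_succ_apply']

open Polynomial in
theorem iteratedDeriv_legendreP (m l : ℕ) :
    iteratedDeriv m (legendreP l) = fun x => (legendreDeriv m l).eval x := by
  have h : legendreP l = fun x => (C (1 / (2 ^ l * (Nat.factorial l : ℝ))) *
      derivative^[l] ((X ^ 2 - 1 : ℝ[X]) ^ l)).eval x := by
    funext x
    have h1 : (fun y : ℝ => (y ^ 2 - 1) ^ l) = fun y => ((X ^ 2 - 1 : ℝ[X]) ^ l).eval y := by
      funext y; simp
    rw [legendreP, h1, iteratedDeriv_eval, eval_mul, eval_C]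
  rw [h, iteratedDeriv_eval]
  funext x
  rw [iterate_derivative_C_mul, ← Function.iterate_add_apply, legendreDeriv, add_comm m l]

open Polynomial in
theorem iterate_derivative_rodrigues_succ (l n : ℕ) :
    derivative^[n + 2] ((X ^ 2 - 1 : ℝ[X]) ^ (l + 1)) =
      2 * ((l : ℝ[X]) + 1) * (X * derivative^[n + 1] ((X ^ 2 - 1) ^ l) +
        ((n : ℝ[X]) + 1) * derivative^[n] ((X ^ 2 - 1) ^ l)) := by
  have h : derivative ((X ^ 2 - 1 : ℝ[X]) ^ (l + 1)) =
      ((2 * (l + 1) : ℕ) : ℝ[X]) * ((X ^ 2 - 1) ^ l * X) := by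
    simp [derivative_pow, map_ofNat]; ring
  rw [show n + 2 = (n + 1) + 1 from rfl, Function.iterate_succ_apply, h,
    iterate_derivative_natCast_mul, iterate_derivative_mul_X]
  simp only [nsmul_eq_mul, Nat.add_sub_cancel]
  push_cast
  ring

open Polynomial in
theorem iterate_derivative_rodrigues_add_two (l n : ℕ) :
    derivative^[n + 2] ((X ^ 2 - 1 : ℝ[X]) ^ (l + 2)) =
      2 * ((l : ℝ[X]) + 2) * ((2 * (l : ℝ[X]) + 3) * derivative^[n] ((X ^ 2 - 1) ^ (l + 1)) +
        2 * ((l : ℝ[X]) + 1) * derivative^[n] ((X ^ 2 - 1) ^ l)) := by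
  have h : derivative (derivative ((X ^ 2 - 1 : ℝ[X]) ^ (l + 2))) =
      ((2 * (l + 2) * (2 * l + 3) : ℕ) : ℝ[X]) * (X ^ 2 - 1) ^ (l + 1) +
        ((2 * (l + 2) * (2 * (l + 1)) : ℕ) : ℝ[X]) * (X ^ 2 - 1) ^ l := by
    simp [derivative_pow, map_ofNat]; ring
  rw [Function.iterate_add_apply]
  simp only [Function.iterate_succ_apply, Function.iterate_zero_apply]
  rw [h, _root_.iterate_map_add, iterate_derivative_natCast_mul, iterate_derivative_natCast_mul]
  push_cast
  ring

open Polynomial in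
/-- The differential equation satisfied by the derivatives of `(X ^ 2 - 1) ^ l`. -/
theorem rodrigues_ode (l n : ℕ) :
    (X ^ 2 - 1 : ℝ[X]) * derivative^[n + 2] ((X ^ 2 - 1 : ℝ[X]) ^ l) =
      2 * ((l : ℝ[X]) - (n : ℝ[X]) - 1) * X * derivative^[n + 1] ((X ^ 2 - 1 : ℝ[X]) ^ l) +
        ((n : ℝ[X]) + 1) * (2 * (l : ℝ[X]) - (n : ℝ[X])) *
          derivative^[n] ((X ^ 2 - 1 : ℝ[X]) ^ l) := by
  induction n with
  | zero =>
    have h : (X ^ 2 - 1 : ℝ[X]) * derivative ((X ^ 2 - 1 : ℝ[X]) ^ l) =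
        2 * (l : ℝ[X]) * X * (X ^ 2 - 1) ^ l := by
      cases l with
      | zero => simp
      | succ l => simp [derivative_pow, map_ofNat]; ring
    have h2 := congrArg derivative h
    simp [derivative_mul] at h2
    simp
    linear_combination h2
  | succ n ih =>
    have h2 := congrArg derivative ih
    simp only [derivative_mul, derivative_add, derivative_sub, derivative_X, derivative_X_sq,
      derivative_one, derivative_natCast, derivative_ofNat,
      ← Function.iterate_succ_apply' derivative] at h2
    simp only [map_ofNat, Nat.succ_eq_add_one] at h2
    push_cast
    linear_combination h2

open Polynomial in
theorem iterate_derivative_rodrigues_two_mul (m : ℕ) :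
    derivative^[2 * m] ((X ^ 2 - 1 : ℝ[X]) ^ m) = C ((2 * m).factorial : ℝ) ∧
      derivative^[2 * m + 2] ((X ^ 2 - 1 : ℝ[X]) ^ m) = 0 := by
  have key : ∀ m : ℕ, derivative^[2 * m] ((X ^ 2 - 1 : ℝ[X]) ^ m) = C ((2 * m).factorial : ℝ) →
      derivative^[2 * m + 2] ((X ^ 2 - 1 : ℝ[X]) ^ m) = 0 := by
    intro m h
    rw [add_comm, Function.iterate_add_apply, h]
    simp
  suffices h : derivative^[2 * m] ((X ^ 2 - 1 : ℝ[X]) ^ m) = C ((2 * m).factorial : ℝ) from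
    ⟨h, key m h⟩
  induction m using Nat.twoStepInduction with
  | zero => simp
  | one =>
    simp [derivative_pow, Nat.factorial]
  | more m ih1 ih2 =>
    rw [show 2 * (m + 2) = 2 * (m + 1) + 2 by ring, iterate_derivative_rodrigues_add_two, ih2,
      show 2 * (m + 1) = 2 * m + 2 by ring, key m ih1, show 2 * m + 2 + 2 = 2 * m + 2 + 1 + 1 from rfl, Nat.factorial_succ (2 * m + 2 + 1),
      Nat.factorial_succ (2 * m + 2)]
    push_cast
    simp only [map_mul, map_add, map_natCast, map_ofNat, map_one]
    ring

open Polynomial in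
theorem legendreDeriv_self (m : ℕ) :
    legendreDeriv m m = C ((2 * m).factorial / (2 ^ m * m.factorial : ℝ)) := by
  rw [legendreDeriv, ← two_mul, (iterate_derivative_rodrigues_two_mul m).1, ← C_mul]
  congr 1
  ring

open Polynomial in
theorem legendreDeriv_recurrence (m l : ℕ) (x : ℝ) :
    ((l : ℝ) + 2 - m) * (legendreDeriv m (l + 2)).eval x =
      (2 * l + 3) * (x * (legendreDeriv m (l + 1)).eval x) -
        (l + 1 + m) * (legendreDeriv m l).eval x := by
  have h1 := congrArg (eval x) (iterate_derivative_rodrigues_succ (l + 1) (l + m))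
  have h2 := congrArg (eval x) (iterate_derivative_rodrigues_add_two l (l + m))
  simp only [eval_mul, eval_add, eval_X, eval_natCast, eval_ofNat, eval_one] at h1 h2
  simp only [legendreDeriv, eval_mul, eval_C, Nat.factorial_succ]
  rw [show l + 2 + m = l + m + 2 by ring, show l + 1 + m = l + m + 1 by ring]
  rw [show l + 1 + 1 = l + 2 from rfl] at h1
  generalize eval x (derivative^[l + m + 2] ((X ^ 2 - 1 : ℝ[X]) ^ (l + 2))) = a at *
  generalize eval x (derivative^[l + m + 1] ((X ^ 2 - 1 : ℝ[X]) ^ (l + 1))) = b at *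
  generalize eval x (derivative^[l + m] ((X ^ 2 - 1 : ℝ[X]) ^ l)) = c at *
  generalize eval x (derivative^[l + m] ((X ^ 2 - 1 : ℝ[X]) ^ (l + 1))) = k at *
  have hl : (l.factorial : ℝ) ≠ 0 := by positivity
  have hl1 : (l : ℝ) + 1 ≠ 0 := by positivity
  have hl2 : (l : ℝ) + 2 ≠ 0 := by positivity
  have key : ((l : ℝ) + 2 - m) * a =
      2 * (l + 2) * ((2 * l + 3) * (x * b) - 2 * (l + 1) * (l + 1 + m) * c) := by
    push_cast at h1 h2
    linear_combination (2 * (l : ℝ) + 3) * h1 - (l + m + 1) * h2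
  push_cast
  rw [show (l : ℝ) + 1 + 1 = l + 2 by ring]
  rw [pow_add, pow_add]
  have hp : (2 : ℝ) ^ l ≠ 0 := by positivity
  generalize (2 : ℝ) ^ l = p at *
  field_simp
  linear_combination key

open Polynomial in
theorem legendreDeriv_succ_self (m : ℕ) (x : ℝ) :
    (legendreDeriv m (m + 1)).eval x = (2 * m + 1) * (x * (legendreDeriv m m).eval x) := by
  cases m with
  | zero => simp [legendreDeriv]; ring
  | succ m =>
    have h := legendreDeriv_recurrence (m + 1) m x
    have h0 : legendreDeriv (m + 1) m = 0 := by
      have h2 : derivative^[2 * m + 1] ((X ^ 2 - 1 : ℝ[X]) ^ m) = 0 := by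
        rw [add_comm, Function.iterate_add_apply, (iterate_derivative_rodrigues_two_mul m).1]
        simp
      rw [legendreDeriv, show m + (m + 1) = 2 * m + 1 by ring, h2, mul_zero]
    rw [h0] at h
    push_cast at h ⊢
    simp only [eval_zero] at h
    linear_combination h

open Polynomial in
theorem integral_legendreDeriv_mul_weight_eq_zero {m l : ℕ} (h : m < l) :
    ∫ x in (-1 : ℝ)..1, (legendreDeriv m l).eval x * (1 - x ^ 2) ^ m = 0 := by
  have hne : ((l : ℝ) + m + 1) * (m - l) ≠ 0 := by
    have h' : (m : ℝ) < l := by exact_mod_cast h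
    exact mul_ne_zero (by positivity) (by linarith)
  let D := legendreDeriv m l
  have ode : ∀ x : ℝ, (1 - x ^ 2) * (derivative (derivative D)).eval x -
      2 * (m + 1) * x * (derivative D).eval x = ((l : ℝ) + m + 1) * (m - l) * D.eval x := by
    intro x
    have h := congrArg (eval x) (rodrigues_ode l (l + m))
    simp only [eval_mul, eval_add, eval_sub, eval_pow, eval_X, eval_natCast, eval_ofNat,
      eval_one] at h
    simp only [D, legendreDeriv, derivative_C_mul, eval_mul, eval_C,
      ← Function.iterate_succ_apply' derivative]
    push_cast at h
    linear_combination (-1 / (2 ^ l * (Nat.factorial l : ℝ))) * h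
  have hder : ∀ x : ℝ, HasDerivAt (fun x => (1 - x ^ 2) ^ (m + 1) * (derivative D).eval x)
      (((l : ℝ) + m + 1) * (m - l) * (D.eval x * (1 - x ^ 2) ^ m)) x := by
    intro x
    have h1 : HasDerivAt (fun x : ℝ => 1 - x ^ 2) (-(2 * x)) x := by
      simpa using (hasDerivAt_pow 2 x).const_sub 1
    refine ((h1.fun_pow (m + 1)).mul ((derivative D).hasDerivAt x)).congr_deriv ?_
    push_cast
    linear_combination (1 - x ^ 2) ^ m * ode x
  have hint := intervalIntegral.integral_eq_sub_of_hasDerivAt (a := -1) (b := 1)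
    (fun x _ => hder x) (Continuous.intervalIntegrable (by fun_prop) _ _)
  rw [intervalIntegral.integral_const_mul] at hint
  simpa [hne] using hint

theorem integral_one_sub_sq_pow (m : ℕ) :
    ∫ x in (-1 : ℝ)..1, (1 - x ^ 2) ^ m =
      2 * 4 ^ m * (m.factorial : ℝ) ^ 2 / (2 * m + 1).factorial := by
  induction m with
  | zero => norm_num
  | succ m ih =>
    have hder : ∀ x : ℝ, HasDerivAt (fun x : ℝ => x * (1 - x ^ 2) ^ (m + 1))
        ((2 * m + 3) * (1 - x ^ 2) ^ (m + 1) - 2 * (m + 1) * (1 - x ^ 2) ^ m) x := by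
      intro x
      have h1 : HasDerivAt (fun x : ℝ => 1 - x ^ 2) (-(2 * x)) x := by
        simpa using (hasDerivAt_pow 2 x).const_sub 1
      refine ((hasDerivAt_id x).mul (h1.fun_pow (m + 1))).congr_deriv ?_
      push_cast
      simp only [id]
      ring
    have hint := intervalIntegral.integral_eq_sub_of_hasDerivAt (a := -1) (b := 1)
      (fun x _ => hder x) (Continuous.intervalIntegrable (by fun_prop) _ _)
    rw [intervalIntegral.integral_sub (Continuous.intervalIntegrable (by fun_prop) _ _)
      (Continuous.intervalIntegrable (by fun_prop) _ _), intervalIntegral.integral_const_mul,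
      intervalIntegral.integral_const_mul, ih] at hint
    have h3 : (2 * (m : ℝ) + 3) ≠ 0 := by positivity
    rw [show 2 * (m + 1) + 1 = 2 * m + 1 + 1 + 1 by ring]
    simp only [Nat.factorial_succ (2 * m + 1 + 1), Nat.factorial_succ (2 * m + 1),
      Nat.factorial_succ m]
    have hf : ((2 * m + 1).factorial : ℝ) ≠ 0 := by positivity
    apply mul_left_cancel₀ h3
    have h2 : (m : ℝ) + 1 ≠ 0 := by positivity
    have e : (2 * (m : ℝ) + 3) * ∫ x in (-1 : ℝ)..1, (1 - x ^ 2) ^ (m + 1) =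
        2 * (m + 1) * (2 * 4 ^ m * (m.factorial : ℝ) ^ 2 / (2 * m + 1).factorial) := by
      have hz : (1 : ℝ) * (1 - 1 ^ 2) ^ (m + 1) - -1 * (1 - (-1) ^ 2) ^ (m + 1) = 0 := by simp
      linear_combination hint + hz
    rw [e]
    push_cast
    have h4 : 2 * (m : ℝ) + 1 + 1 + 1 ≠ 0 := by positivity
    have h5 : 2 * (m : ℝ) + 1 + 1 ≠ 0 := by positivity
    field_simp
    ring

/-- The function of the second kind attached to `legendreDeriv m l`. -/
noncomputable def legendreQ (m l : ℕ) (w : ℝ) : ℝ :=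
  (1 / 2) * ∫ x in (-1 : ℝ)..1, (legendreDeriv m l).eval x / (w - x) * (1 - x ^ 2) ^ m

theorem sub_ne_zero_of_mem_uIcc {w : ℝ} (hw : 1 < |w|) {x : ℝ} (hx : x ∈ Set.uIcc (-1 : ℝ) 1) :
    w - x ≠ 0 := by
  rw [Set.uIcc_of_le (by norm_num)] at hx
  intro h
  rw [sub_eq_zero.mp h] at hw
  exact absurd (abs_le.mpr hx) (not_le.mpr hw)

open Polynomial in
theorem intervalIntegrable_stieltjes {w : ℝ} (hw : 1 < |w|) (m : ℕ) (p : ℝ[X]) :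
    IntervalIntegrable (fun x => p.eval x / (w - x) * (1 - x ^ 2) ^ m) volume (-1) 1 := by
  apply ContinuousOn.intervalIntegrable
  exact (p.continuous.continuousOn.div (by fun_prop) fun x hx => sub_ne_zero_of_mem_uIcc hw hx).mul
    (by fun_prop)

open Polynomial in
theorem integral_mul_stieltjes {w : ℝ} (hw : 1 < |w|) (m : ℕ) (p : ℝ[X]) :
    ∫ x in (-1 : ℝ)..1, (x * p.eval x) / (w - x) * (1 - x ^ 2) ^ m =
      w * (∫ x in (-1 : ℝ)..1, p.eval x / (w - x) * (1 - x ^ 2) ^ m) -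
        ∫ x in (-1 : ℝ)..1, p.eval x * (1 - x ^ 2) ^ m := by
  rw [← intervalIntegral.integral_const_mul, ← intervalIntegral.integral_sub
    ((intervalIntegrable_stieltjes hw m p).const_mul w)
    (Continuous.intervalIntegrable (by fun_prop) _ _)]
  refine intervalIntegral.integral_congr fun x hx => ?_
  have := sub_ne_zero_of_mem_uIcc hw hx
  field_simp
  ring

open Polynomial in
theorem legendreQ_recurrence {m l : ℕ} (h : m ≤ l) {w : ℝ} (hw : 1 < |w|) :
    ((l : ℝ) + 2 - m) * legendreQ m (l + 2) w =
      (2 * l + 3) * (w * legendreQ m (l + 1) w) - (l + 1 + m) * legendreQ m l w := by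
  have hx := integral_mul_stieltjes hw m (legendreDeriv m (l + 1))
  rw [integral_legendreDeriv_mul_weight_eq_zero (Nat.lt_succ_of_le h), sub_zero] at hx
  have hX : IntervalIntegrable (fun x => (x * (legendreDeriv m (l + 1)).eval x) / (w - x) *
      (1 - x ^ 2) ^ m) volume (-1) 1 := by
    refine (intervalIntegrable_stieltjes hw m (X * legendreDeriv m (l + 1))).congr fun x _ => ?_
    simp only [eval_mul, eval_X]
  have key : ((l : ℝ) + 2 - m) * (∫ x in (-1 : ℝ)..1,
        (legendreDeriv m (l + 2)).eval x / (w - x) * (1 - x ^ 2) ^ m) =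
      (2 * l + 3) * (∫ x in (-1 : ℝ)..1,
        (x * (legendreDeriv m (l + 1)).eval x) / (w - x) * (1 - x ^ 2) ^ m) -
      (l + 1 + m) * (∫ x in (-1 : ℝ)..1,
        (legendreDeriv m l).eval x / (w - x) * (1 - x ^ 2) ^ m) := by
    rw [← intervalIntegral.integral_const_mul, ← intervalIntegral.integral_const_mul,
      ← intervalIntegral.integral_const_mul, ← intervalIntegral.integral_sub (hX.const_mul _)
      ((intervalIntegrable_stieltjes hw m _).const_mul _)]
    refine intervalIntegral.integral_congr fun x _ => ?_
    linear_combination (1 - x ^ 2) ^ m / (w - x) * legendreDeriv_recurrence m l x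
  rw [hx] at key
  simp only [legendreQ]
  linear_combination (1 / 2) * key

open Polynomial in
theorem legendreQ_succ_self (m : ℕ) {w : ℝ} (hw : 1 < |w|) :
    legendreQ m (m + 1) w = (2 * m + 1) * (w * legendreQ m m w) -
      2 ^ m * m.factorial := by
  have hx := integral_mul_stieltjes hw m (legendreDeriv m m)
  have key : (∫ x in (-1 : ℝ)..1,
        (legendreDeriv m (m + 1)).eval x / (w - x) * (1 - x ^ 2) ^ m) =
      (2 * (m : ℝ) + 1) * (∫ x in (-1 : ℝ)..1,
        (x * (legendreDeriv m m).eval x) / (w - x) * (1 - x ^ 2) ^ m) := by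
    rw [← intervalIntegral.integral_const_mul]
    refine intervalIntegral.integral_congr fun x _ => ?_
    linear_combination (1 - x ^ 2) ^ m / (w - x) * legendreDeriv_succ_self m x
  have hI : (2 * (m : ℝ) + 1) * ∫ x in (-1 : ℝ)..1, (legendreDeriv m m).eval x * (1 - x ^ 2) ^ m =
      2 * (2 ^ m * m.factorial) := by
    simp only [legendreDeriv_self, eval_C]
    rw [intervalIntegral.integral_const_mul, integral_one_sub_sq_pow, Nat.factorial_succ,
      show (4 : ℝ) ^ m = 2 ^ m * 2 ^ m by rw [← mul_pow]; norm_num]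
    have h1 : ((2 * m).factorial : ℝ) ≠ 0 := by positivity
    have h2 : (m.factorial : ℝ) ≠ 0 := by positivity
    have h3 : 2 * (m : ℝ) + 1 ≠ 0 := by positivity
    push_cast
    field_simp
  simp only [legendreQ]
  linear_combination (1 / 2) * key + (1 / 2) * (2 * (m : ℝ) + 1) * hx - (1 / 2) * hI

/-- The Christoffel-type determinant of the unnormalized functions of both kinds. -/
theorem legendreDeriv_legendreQ_det (m n : ℕ) {w : ℝ} (hw : 1 < |w|) :
    ((n + 1).factorial : ℝ) * ((legendreDeriv m (m + n + 1)).eval w * legendreQ m (m + n) w -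
      (legendreDeriv m (m + n)).eval w * legendreQ m (m + n + 1) w) =
      ((2 * m + n).factorial : ℝ) := by
  induction n with
  | zero =>
    simp only [add_zero]
    rw [legendreDeriv_succ_self, legendreQ_succ_self m hw, legendreDeriv_self]
    simp only [Polynomial.eval_C, zero_add, Nat.factorial_one, Nat.cast_one]
    field_simp
    ring
  | succ n ih =>
    have hP := legendreDeriv_recurrence m (m + n) w
    have hQ := legendreQ_recurrence (Nat.le_add_right m n) hw
    rw [show m + (n + 1) = m + n + 1 from rfl, show m + n + 1 + 1 = m + n + 2 from rfl,
      show 2 * m + (n + 1) = 2 * m + n + 1 from rfl, Nat.factorial_succ (n + 1),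
      Nat.factorial_succ (2 * m + n), Nat.cast_mul, Nat.cast_mul, ← ih]
    push_cast at hP hQ ⊢
    linear_combination ((n + 1).factorial : ℝ) * legendreQ m (m + n + 1) w * hP -
      ((n + 1).factorial : ℝ) * (legendreDeriv m (m + n + 1)).eval w * hQ

theorem pml_eq (m l : ℕ) (x : ℝ) :
    pml m l x = Real.sqrt ((Nat.factorial (l - m) : ℝ) / (Nat.factorial (l + m) : ℝ)) *
      (legendreDeriv m l).eval x := by
  rw [pml, iteratedDeriv_legendreP]

theorem qml_eq (m l : ℕ) (w : ℝ) :
    qml m l w = Real.sqrt ((Nat.factorial (l - m) : ℝ) / (Nat.factorial (l + m) : ℝ)) *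
      legendreQ m l w := by
  simp only [qml, legendreQ, pml_eq, mul_div_assoc, mul_assoc,
    intervalIntegral.integral_const_mul]
  ring

/-- `√((l_B+1)²−m²) (p_{l_B+1}^m(ν) q_{l_B}^m(ν) − p_{l_B}^m(ν) q_{l_B+1}^m(ν)) = 1`. -/
theorem stmt_2 (m : ℕ) (lB : ℕ) (hlB : m ≤ lB) (ν : ℝ) (hν : 1 < |ν|) :
    Real.sqrt (((lB : ℝ) + 1) ^ 2 - (m : ℝ) ^ 2) *
      (pml m (lB + 1) ν * qml m lB ν - pml m lB ν * qml m (lB + 1) ν) = 1 := by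
  obtain ⟨n, rfl⟩ := Nat.exists_eq_add_of_le hlB
  rw [pml_eq, pml_eq, qml_eq, qml_eq]
  have hdet := legendreDeriv_legendreQ_det m n hν
  have hnorm : Real.sqrt ((((m + n : ℕ) : ℝ) + 1) ^ 2 - (m : ℝ) ^ 2) *
      (Real.sqrt ((Nat.factorial (m + n + 1 - m) : ℝ) / (Nat.factorial (m + n + 1 + m) : ℝ)) *
        Real.sqrt ((Nat.factorial (m + n - m) : ℝ) / (Nat.factorial (m + n + m) : ℝ))) =
      ((n + 1).factorial : ℝ) / (2 * m + n).factorial := by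
    rw [show m + n + 1 - m = n + 1 by omega, show m + n - m = n by omega,
      show m + n + 1 + m = 2 * m + n + 1 by ring, show m + n + m = 2 * m + n by ring,
      ← Real.sqrt_mul (by positivity), ← Real.sqrt_mul (by
        push_cast
        nlinarith [mul_nonneg (m.cast_nonneg (α := ℝ)) (n.cast_nonneg (α := ℝ))]),
      Real.sqrt_eq_iff_mul_self_eq_of_pos (by positivity), Nat.factorial_succ, Nat.factorial_succ]
    push_cast
    field_simp
    ring
  have hf : ((2 * m + n).factorial : ℝ) ≠ 0 := by positivity
  calc _ = (Real.sqrt ((((m + n : ℕ) : ℝ) + 1) ^ 2 - (m : ℝ) ^ 2) *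
      (Real.sqrt ((Nat.factorial (m + n + 1 - m) : ℝ) / (Nat.factorial (m + n + 1 + m) : ℝ)) *
        Real.sqrt ((Nat.factorial (m + n - m) : ℝ) / (Nat.factorial (m + n + m) : ℝ)))) *
      ((legendreDeriv m (m + n + 1)).eval ν * legendreQ m (m + n) ν -
        (legendreDeriv m (m + n)).eval ν * legendreQ m (m + n + 1) ν) := by ring
    _ = 1 := by
      rw [hnorm, div_mul_eq_mul_div, hdet, div_self hf]
end

section
/- For every integer l_B ≥ L and every real ν, ϖ ν g^m(ν,ν) = √((l_B+1)² − m²) · ( p_{l_B+1}^m(ν) g_{l_B}^m(ν) − p_{l_B}^m(ν) g_{l_B+1}^m(ν) ), where g^m(ν,ν) denotes the value of the function μ ↦ g^m(ν,μ) at μ = ν. -/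
open MeasureTheory Filter

open Polynomial in
/-- Iterated derivatives of polynomial functions are given by formal derivatives. -/
lemma iteratedDeriv_polynomial_eval (p : ℝ[X]) (k : ℕ) :
    iteratedDeriv k (fun x => p.eval x) = fun x => (derivative^[k] p).eval x := by
  induction k with
  | zero => simp
  | succ k ih =>
    rw [iteratedDeriv_succ, ih, Function.iterate_succ_apply']
    funext x
    exact Polynomial.deriv _

open Polynomial in
/-- The `k`-th derivative of the polynomial `(X² - 1)^l`. -/
noncomputable def rodriguesDeriv (l k : ℕ) : ℝ[X] := derivative^[k] ((X ^ 2 - 1) ^ l)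

open Polynomial in
lemma iteratedDeriv_legendreP_s3 (m l : ℕ) (x : ℝ) :
    iteratedDeriv m (legendreP l) x =
      1 / (2 ^ l * (Nat.factorial l : ℝ)) * (rodriguesDeriv l (l + m)).eval x := by
  have h : legendreP l = fun x =>
      (C (1 / (2 ^ l * (Nat.factorial l : ℝ))) * rodriguesDeriv l l).eval x := by
    funext y
    have h1 : (fun y : ℝ => (y ^ 2 - 1) ^ l) =
        fun y => (((X : ℝ[X]) ^ 2 - 1) ^ l).eval y := by
      funext z; simp
    rw [legendreP, h1, iteratedDeriv_polynomial_eval, eval_mul, eval_C, rodriguesDeriv]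
  rw [h, iteratedDeriv_polynomial_eval]
  simp only [iterate_derivative_C_mul, eval_mul, eval_C, rodriguesDeriv]
  rw [← Function.iterate_add_apply, add_comm m l]

open Polynomial in
lemma rodriguesDeriv_succ_succ (l k : ℕ) :
    rodriguesDeriv (l + 1) (k + 1) =
      C (2 * ((l : ℝ) + 1)) * (X * rodriguesDeriv l k + C (k : ℝ) * rodriguesDeriv l (k - 1)) := by
  have h : derivative (((X : ℝ[X]) ^ 2 - 1) ^ (l + 1)) =
      C (2 * ((l : ℝ) + 1)) * (X * (X ^ 2 - 1) ^ l) := by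
    simp [derivative_pow, show (C (2 : ℝ)) = 2 from rfl]
    ring
  simp only [rodriguesDeriv, Function.iterate_succ_apply]
  rw [h, iterate_derivative_C_mul, mul_comm X, iterate_derivative_mul_X]
  simp [mul_comm X]

open Polynomial in
lemma rodriguesDeriv_add_two (l k : ℕ) :
    rodriguesDeriv (l + 2) (k + 2) =
      C (2 * ((l : ℝ) + 2)) * (C (2 * (l : ℝ) + 3) * rodriguesDeriv (l + 1) k +
        C (2 * ((l : ℝ) + 1)) * rodriguesDeriv l k) := by
  have h : derivative (derivative (((X : ℝ[X]) ^ 2 - 1) ^ (l + 2))) =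
      C (2 * ((l : ℝ) + 2)) * (C (2 * (l : ℝ) + 3) * (X ^ 2 - 1) ^ (l + 1) +
        C (2 * ((l : ℝ) + 1)) * (X ^ 2 - 1) ^ l) := by
    simp [derivative_pow, show (C (2 : ℝ)) = 2 from rfl, show (C (3 : ℝ)) = 3 from rfl]
    ring
  simp only [rodriguesDeriv, Function.iterate_succ_apply]
  rw [h, iterate_derivative_C_mul, iterate_map_add, iterate_derivative_C_mul,
    iterate_derivative_C_mul]

open Polynomial in
lemma rodriguesDeriv_eq_zero {l k : ℕ} (h : 2 * l < k) : rodriguesDeriv l k = 0 := by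
  refine iterate_derivative_eq_zero (lt_of_le_of_lt ?_ h)
  compute_degree
  omega

/-- Three-term recurrence for the `m`-th derivatives of the Legendre polynomials. -/
lemma iteratedDeriv_legendreP_recurrence (m l : ℕ) (x : ℝ) :
    (2 * (l : ℝ) + 3) * x * iteratedDeriv m (legendreP (l + 1)) x =
      ((l : ℝ) + 2 - m) * iteratedDeriv m (legendreP (l + 2)) x +
        ((l : ℝ) + 1 + m) * iteratedDeriv m (legendreP l) x := by
  have h1 := congrArg (Polynomial.eval x) (rodriguesDeriv_succ_succ (l + 1) (l + 1 + m))
  have h2 := congrArg (Polynomial.eval x) (rodriguesDeriv_add_two l (l + m))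
  rw [show l + 1 + m - 1 = l + m by omega, show l + 1 + m + 1 = l + m + 2 by omega] at h1
  simp only [iteratedDeriv_legendreP_s3]
  rw [show l + 1 + m = l + m + 1 by omega, show l + 2 + m = l + m + 2 by omega] at *
  simp only [Polynomial.eval_mul, Polynomial.eval_add, Polynomial.eval_C, Polynomial.eval_X,
    Nat.factorial_succ, pow_succ] at *
  push_cast at *
  linear_combination (norm := (field_simp; ring))
    -(1 / (2 ^ l * 2 * 2 * (((l : ℝ) + 1 + 1) * (((l : ℝ) + 1) * (Nat.factorial l : ℝ))))) *
      ((2 * (l : ℝ) + 3) * h1 - ((l : ℝ) + 1 + m) * h2)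

lemma iteratedDeriv_legendreP_eq_zero {m l : ℕ} (h : l < m) (x : ℝ) :
    iteratedDeriv m (legendreP l) x = 0 := by
  rw [iteratedDeriv_legendreP_s3, rodriguesDeriv_eq_zero (by omega)]
  simp

lemma iteratedDeriv_legendreP_succ_self (m : ℕ) (x : ℝ) :
    iteratedDeriv m (legendreP (m + 1)) x = (2 * m + 1) * x * iteratedDeriv m (legendreP m) x := by
  cases m with
  | zero =>
    simp only [iteratedDeriv_legendreP_s3]
    rw [show 0 + 1 + 0 = 0 + 1 by rfl, rodriguesDeriv_succ_succ]
    simp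
  | succ m =>
    have h := iteratedDeriv_legendreP_recurrence (m + 1) m x
    rw [iteratedDeriv_legendreP_eq_zero (Nat.lt_succ_self m)] at h
    push_cast at *
    linarith

/-- The normalization ratio of consecutive `pml`. -/
lemma sqrt_mul_sqrt_factorial_div (m n : ℕ) :
    Real.sqrt (((m + n + 1 : ℕ) : ℝ) ^ 2 - (m : ℝ) ^ 2) *
        Real.sqrt ((Nat.factorial (n + 1) : ℝ) / (Nat.factorial (m + n + 1 + m) : ℝ)) =
      (n + 1) * Real.sqrt ((Nat.factorial n : ℝ) / (Nat.factorial (m + n + m) : ℝ)) ∧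
    Real.sqrt (((m + n + 1 : ℕ) : ℝ) ^ 2 - (m : ℝ) ^ 2) *
        Real.sqrt ((Nat.factorial n : ℝ) / (Nat.factorial (m + n + m) : ℝ)) =
      (2 * m + n + 1) *
        Real.sqrt ((Nat.factorial (n + 1) : ℝ) / (Nat.factorial (m + n + 1 + m) : ℝ)) := by
  have ha : (0 : ℝ) ≤ ((m + n + 1 : ℕ) : ℝ) ^ 2 - (m : ℝ) ^ 2 := by
    push_cast
    nlinarith [Nat.cast_nonneg (α := ℝ) m, Nat.cast_nonneg (α := ℝ) n]
  have e1 : ((n : ℝ) + 1) = Real.sqrt (((n : ℝ) + 1) ^ 2) := (Real.sqrt_sq (by positivity)).symm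
  have e2 : (2 * (m : ℝ) + n + 1) = Real.sqrt ((2 * (m : ℝ) + n + 1) ^ 2) :=
    (Real.sqrt_sq (by positivity)).symm
  rw [show m + n + 1 + m = m + n + m + 1 by omega]
  constructor
  · rw [e1, ← Real.sqrt_mul ha, ← Real.sqrt_mul (by positivity)]
    congr 1
    simp only [Nat.factorial_succ]
    push_cast
    field_simp
    ring
  · rw [e2, ← Real.sqrt_mul ha, ← Real.sqrt_mul (by positivity)]
    congr 1
    simp only [Nat.factorial_succ]
    push_cast
    field_simp
    ring

/-- First step of the recurrence of `pml`. -/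
lemma pml_recurrence_self (m : ℕ) (x : ℝ) :
    x * (2 * m + 1) * pml m m x =
      Real.sqrt (((m + 1 : ℕ) : ℝ) ^ 2 - (m : ℝ) ^ 2) * pml m (m + 1) x := by
  have h := (sqrt_mul_sqrt_factorial_div m 0).1
  have h2 := iteratedDeriv_legendreP_succ_self m x
  simp only [add_zero, zero_add] at h
  rw [pml, pml, Nat.sub_self, Nat.add_sub_cancel_left, ← mul_assoc (Real.sqrt _) (Real.sqrt _), h,
    h2]
  push_cast
  ring

/-- Three-term recurrence of `pml`. -/
lemma pml_recurrence (m n : ℕ) (x : ℝ) :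
    x * (2 * ((m + n + 1 : ℕ) : ℝ) + 1) * pml m (m + n + 1) x =
      Real.sqrt (((m + n + 2 : ℕ) : ℝ) ^ 2 - (m : ℝ) ^ 2) * pml m (m + n + 2) x +
        Real.sqrt (((m + n + 1 : ℕ) : ℝ) ^ 2 - (m : ℝ) ^ 2) * pml m (m + n) x := by
  have h1 := (sqrt_mul_sqrt_factorial_div m (n + 1)).1
  have h2 := (sqrt_mul_sqrt_factorial_div m n).2
  have h := iteratedDeriv_legendreP_recurrence m (m + n) x
  rw [← add_assoc m n 1] at h1
  simp only [pml]
  rw [show m + n + 2 - m = n + 1 + 1 by omega, show m + n + 1 - m = n + 1 by omega,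
    show m + n - m = n by omega, show m + n + 2 = m + n + 1 + 1 by rfl,
    ← mul_assoc (Real.sqrt _) (Real.sqrt _), ← mul_assoc (Real.sqrt _) (Real.sqrt _), h1, h2]
  push_cast at *
  linear_combination
    Real.sqrt ((Nat.factorial (n + 1) : ℝ) / (Nat.factorial (m + n + 1 + m) : ℝ)) * h

/-- First step of the recurrence of `gml`. -/
lemma gml_recurrence_self (ϖ : ℝ) (β : ℕ → ℝ) (L m : ℕ) (ν : ℝ) :
    ν * hcoef ϖ β L m * gml ϖ β L m m ν =
      Real.sqrt (((m + 1 : ℕ) : ℝ) ^ 2 - (m : ℝ) ^ 2) * gml ϖ β L m (m + 1) ν := by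
  have h : Real.sqrt (((m : ℝ) + 1) ^ 2 - (m : ℝ) ^ 2) ≠ 0 :=
    (Real.sqrt_pos.2 (by nlinarith [Nat.cast_nonneg (α := ℝ) m])).ne'
  simp only [gml, lt_irrefl, if_false, Nat.sub_self, Nat.add_sub_cancel_left, chandraAux,
    show ¬ m + 1 < m by omega]
  push_cast
  field_simp

/-- Three-term recurrence of `gml`. -/
lemma gml_recurrence (ϖ : ℝ) (β : ℕ → ℝ) (L m n : ℕ) (ν : ℝ) :
    ν * hcoef ϖ β L (m + n + 1) * gml ϖ β L m (m + n + 1) ν =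
      Real.sqrt (((m + n + 2 : ℕ) : ℝ) ^ 2 - (m : ℝ) ^ 2) * gml ϖ β L m (m + n + 2) ν +
        Real.sqrt (((m + n + 1 : ℕ) : ℝ) ^ 2 - (m : ℝ) ^ 2) * gml ϖ β L m (m + n) ν := by
  have h : Real.sqrt (((m + n + 2 : ℕ) : ℝ) ^ 2 - (m : ℝ) ^ 2) ≠ 0 := by
    refine (Real.sqrt_pos.2 ?_).ne'
    push_cast
    nlinarith [Nat.cast_nonneg (α := ℝ) m, Nat.cast_nonneg (α := ℝ) n]
  simp only [gml, show ¬ m + n + 2 < m by omega, show ¬ m + n + 1 < m by omega,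
    show ¬ m + n < m by omega, if_false, show m + n + 2 - m = n + 2 by omega,
    show m + n + 1 - m = n + 1 by omega, show m + n - m = n by omega]
  rw [chandraAux, mul_div_cancel₀ _ h]
  ring

/-- Christoffel–Darboux type identity for the pair `pml`, `gml`. -/
lemma sum_pml_mul_gml (ϖ : ℝ) (β : ℕ → ℝ) (L m n : ℕ) (ν : ℝ) :
    ν * ∑ l ∈ Finset.Icc m (m + n),
        (2 * (l : ℝ) + 1 - hcoef ϖ β L l) * (pml m l ν * gml ϖ β L m l ν) =
      Real.sqrt (((m + n + 1 : ℕ) : ℝ) ^ 2 - (m : ℝ) ^ 2) *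
        (pml m (m + n + 1) ν * gml ϖ β L m (m + n) ν -
          pml m (m + n) ν * gml ϖ β L m (m + n + 1) ν) := by
  induction n with
  | zero =>
    have h1 := pml_recurrence_self m ν
    have h2 := gml_recurrence_self ϖ β L m ν
    simp only [add_zero, Finset.Icc_self, Finset.sum_singleton]
    linear_combination gml ϖ β L m m ν * h1 - pml m m ν * h2
  | succ n ih =>
    have h1 := pml_recurrence m n ν
    have h2 := gml_recurrence ϖ β L m n ν
    rw [← add_assoc m n 1, Finset.sum_Icc_succ_top (by omega), mul_add, ih]
    linear_combination gml ϖ β L m (m + n + 1) ν * h1 - pml m (m + n + 1) ν * h2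

/-- `ϖ ν g^m(ν,ν) = √((l_B+1)²−m²) (p_{l_B+1}^m(ν) g_{l_B}^m(ν) − p_{l_B}^m(ν) g_{l_B+1}^m(ν))`. -/
theorem stmt_3 (L : ℕ) (hL : 1 ≤ L) (ϖ : ℝ) (hϖ : ϖ ∈ Set.Ioo (0 : ℝ) 1)
    (β : ℕ → ℝ) (hβ0 : β 0 = 1)
    (hβ : ∀ l : ℕ, 1 ≤ l → l ≤ L → β l ∈ Set.Ioo (0 : ℝ) (2 * (l : ℝ) + 1))
    (m : ℕ) (hm : m ≤ L)
    (lB : ℕ) (hlB : L ≤ lB) (ν : ℝ) :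
    ϖ * ν * gfun ϖ β L m ν ν =
      Real.sqrt (((lB : ℝ) + 1) ^ 2 - (m : ℝ) ^ 2) *
        (pml m (lB + 1) ν * gml ϖ β L m lB ν -
          pml m lB ν * gml ϖ β L m (lB + 1) ν) := by
  obtain ⟨n, rfl⟩ := Nat.exists_eq_add_of_le (hm.trans hlB)
  have h := sum_pml_mul_gml ϖ β L m n ν
  push_cast at h ⊢
  rw [← h, gfun, mul_comm ϖ ν, mul_assoc, Finset.mul_sum]
  congr 1
  refine Finset.sum_subset_zero_on_sdiff (Finset.Icc_subset_Icc_right hlB) ?_ ?_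
  · intro l hl
    have : ¬ l ≤ L := by simp at hl; omega
    simp [hcoef, this]
  · intro l hl
    rw [hcoef, if_pos (Finset.mem_Icc.1 hl).2]
    ring
end
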